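/- arXiv:1407.8465 — 2 statements merged into one kernel-verified Lean document; each statement's English description precedes it below -/
import Mathlib

section
/- Let p > 3 be a prime. Then (-1)^{(p-1)/2} · Σ_{k=0}^{p-1} binom(6k,3k)·binom(3k,k)/432^k · H_k ≡ -3·q_p(3) − 4·q_p(2) + p·((3/2)·q_p(3)² + 2·q_p(2)²) (mod p²), where (-1)^{(p-1)/2} equals the Legendre symbol (-1/p). -/
open Finset

/-- Generalized binomial coefficient `C(a,k) = a(a-1)⋯(a-k+1)/k!` for a rational `a`. -/
noncomputable def gchoose (a : ℚ) (k : ℕ) : ℚ :=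
  (∏ j ∈ Finset.range k, (a - j)) / (Nat.factorial k : ℚ)

/-- The harmonic number `H_k = ∑_{j=1}^k 1/j`. -/
def harm (k : ℕ) : ℚ := ∑ j ∈ Finset.range k, (1 : ℚ) / (j + 1)

/-- The second-order harmonic number `H_k^{(2)} = ∑_{j=1}^k 1/j²`. -/
def harm2 (k : ℕ) : ℚ := ∑ j ∈ Finset.range k, (1 : ℚ) / (j + 1) ^ 2

/-- `x ≡ y (mod p^m)` for rationals: the p-adic valuation of `x - y` is at least `m`
(with the convention that the valuation of `0` is `+∞`). -/
def CongrMod (p m : ℕ) (x y : ℚ) : Prop :=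
  x = y ∨ (m : ℤ) ≤ padicValRat p (x - y)

/-- The Bernoulli polynomial `B_n` evaluated at a rational `x`. -/
noncomputable def bpoly (n : ℕ) (x : ℚ) : ℚ := (Polynomial.bernoulli n).eval x

/-- The Euler polynomial `E_n` evaluated at a rational `x`, via
`E_n(x) = (2/(n+1))·(B_{n+1}(x) − 2^{n+1}·B_{n+1}(x/2))`. -/
noncomputable def epoly (n : ℕ) (x : ℚ) : ℚ :=
  (2 / (n + 1 : ℚ)) * (bpoly (n + 1) x - 2 ^ (n + 1) * bpoly (n + 1) (x / 2))

/-- The Euler number `E_n = 2^n · E_n(1/2)`. -/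
noncomputable def eulerNum (n : ℕ) : ℚ := 2 ^ n * epoly n (1 / 2)

/-- `p ^ m` divides the rational number `x` in the localization of `ℤ` at `p`. -/
def PDiv (p m : ℕ) (x : ℚ) : Prop :=
  ∃ a b : ℤ, ¬ (p : ℤ) ∣ b ∧ x * b = (p : ℚ) ^ m * a

namespace PDiv

variable {p : ℕ}

theorem mul (hp : p.Prime) {m k : ℕ} {x y : ℚ} (hx : PDiv p m x) (hy : PDiv p k y) :
    PDiv p (m + k) (x * y) := by
  obtain ⟨a, b, hb, h⟩ := hx
  obtain ⟨c, d, hd, h'⟩ := hy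
  refine ⟨a * c, b * d, fun H => ?_, ?_⟩
  · rcases (Nat.prime_iff_prime_int.mp hp).dvd_or_dvd H with H | H
    · exact hb H
    · exact hd H
  · push_cast
    rw [pow_add]
    linear_combination (y * d) * h + ((p : ℚ) ^ m * a) * h'

theorem add (hp : p.Prime) {m : ℕ} {x y : ℚ} (hx : PDiv p m x) (hy : PDiv p m y) :
    PDiv p m (x + y) := by
  obtain ⟨a, b, hb, h⟩ := hx
  obtain ⟨c, d, hd, h'⟩ := hy
  refine ⟨a * d + b * c, b * d, fun H => ?_, ?_⟩
  · rcases (Nat.prime_iff_prime_int.mp hp).dvd_or_dvd H with H | H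
    · exact hb H
    · exact hd H
  · push_cast
    linear_combination (d : ℚ) * h + (b : ℚ) * h'

theorem int (hp : p.Prime) (z : ℤ) : PDiv p 0 (z : ℚ) :=
  ⟨z, 1, (Nat.prime_iff_prime_int.mp hp).not_dvd_one, by simp⟩

theorem nat (hp : p.Prime) (z : ℕ) : PDiv p 0 (z : ℚ) := by
  simpa using int hp (z : ℤ)

theorem zero (hp : p.Prime) (m : ℕ) : PDiv p m 0 :=
  ⟨0, 1, (Nat.prime_iff_prime_int.mp hp).not_dvd_one, by simp⟩

theorem self (hp : p.Prime) : PDiv p 1 (p : ℚ) :=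
  ⟨1, 1, (Nat.prime_iff_prime_int.mp hp).not_dvd_one, by simp⟩

theorem inv_int {z : ℤ} (hz : ¬ (p : ℤ) ∣ z) : PDiv p 0 ((z : ℚ)⁻¹) := by
  refine ⟨1, z, hz, ?_⟩
  have : (z : ℚ) ≠ 0 := by
    rintro h
    exact hz (by simp [Int.cast_eq_zero.mp h])
  simp [this]

theorem inv_nat {z : ℕ} (h0 : 0 < z) (hz : z < p) : PDiv p 0 ((z : ℚ)⁻¹) := by
  have : ¬ (p : ℤ) ∣ (z : ℤ) := by
    rw [Int.natCast_dvd_natCast]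
    exact Nat.not_dvd_of_pos_of_lt h0 hz
  simpa using inv_int this

theorem mulLeft (hp : p.Prime) {m : ℕ} {x y : ℚ} (hx : PDiv p 0 x) (hy : PDiv p m y) :
    PDiv p m (x * y) := by
  simpa using hx.mul hp hy

theorem mulRight (hp : p.Prime) {m : ℕ} {x y : ℚ} (hx : PDiv p m x) (hy : PDiv p 0 y) :
    PDiv p m (x * y) := by
  simpa using hx.mul hp hy

theorem neg (hp : p.Prime) {m : ℕ} {x : ℚ} (hx : PDiv p m x) : PDiv p m (-x) := by
  simpa using (int hp (-1)).mulLeft hp hx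

theorem sub (hp : p.Prime) {m : ℕ} {x y : ℚ} (hx : PDiv p m x) (hy : PDiv p m y) :
    PDiv p m (x - y) := by
  simpa [sub_eq_add_neg] using hx.add hp (hy.neg hp)

theorem mono {m k : ℕ} {x : ℚ} (h : m ≤ k) (hx : PDiv p k x) : PDiv p m x := by
  obtain ⟨a, b, hb, h'⟩ := hx
  obtain ⟨c, rfl⟩ := Nat.exists_eq_add_of_le h
  exact ⟨p ^ c * a, b, hb, by push_cast; rw [h', pow_add]; ring⟩

theorem sum (hp : p.Prime) {m : ℕ} {ι : Type*} (s : Finset ι) {f : ι → ℚ}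
    (h : ∀ i ∈ s, PDiv p m (f i)) : PDiv p m (∑ i ∈ s, f i) :=
  Finset.sum_induction f (PDiv p m) (fun _ _ hx hy => hx.add hp hy) (zero hp m) h

theorem prod (hp : p.Prime) {ι : Type*} (s : Finset ι) {f : ι → ℚ}
    (h : ∀ i ∈ s, PDiv p 0 (f i)) : PDiv p 0 (∏ i ∈ s, f i) :=
  Finset.prod_induction f (PDiv p 0) (fun _ _ hx hy => hx.mul hp hy)
    (by simpa using int hp 1) h

theorem prod_of_mem (hp : p.Prime) {ι : Type*} [DecidableEq ι] (s : Finset ι) {f : ι → ℚ}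
    (h : ∀ i ∈ s, PDiv p 0 (f i)) {i : ι} (hi : i ∈ s) (h1 : PDiv p 1 (f i)) :
    PDiv p 1 (∏ i ∈ s, f i) := by
  rw [← Finset.mul_prod_erase s f hi]
  exact h1.mulRight hp (prod hp _ fun j hj => h j (Finset.mem_of_mem_erase hj))

theorem congrMod (hp : p.Prime) {m : ℕ} {x y : ℚ} (h : PDiv p m (x - y)) :
    CongrMod p m x y := by
  have := Fact.mk hp
  by_cases hxy : x = y
  · exact Or.inl hxy
  right
  have hne : x - y ≠ 0 := sub_ne_zero.mpr hxy
  obtain ⟨a, b, hb, h⟩ := h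
  have hb0 : (b : ℚ) ≠ 0 := by
    intro h
    exact hb (by simp [Int.cast_eq_zero.mp h])
  have hp0 : (p : ℚ) ≠ 0 := by exact_mod_cast hp.ne_zero
  have ha0 : (a : ℚ) ≠ 0 := by
    intro h0
    rw [h0, mul_zero] at h
    exact mul_ne_zero hne hb0 h
  have h2 := congrArg (padicValRat p) h
  rw [padicValRat.mul hne hb0, padicValRat.mul (pow_ne_zero _ hp0) ha0, padicValRat.pow,
    padicValRat.self hp.one_lt, padicValRat.of_int, padicValRat.of_int,
    padicValInt.eq_zero_of_not_dvd hb] at h2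
  have : (0 : ℤ) ≤ (padicValInt p a : ℤ) := Int.natCast_nonneg _
  push_cast at h2
  linarith

end PDiv

/-- The product `C(a, k) * C(-1 - a, k)` of generalized binomial coefficients. -/
def binomPair (a : ℚ) (k : ℕ) : ℚ :=
  (∏ j ∈ range k, (a - j) / (j + 1)) * ∏ j ∈ range k, (-1 - a - j) / (j + 1)

/-- The product `C(a - 1, k) * C(-1 - a, k)` of generalized binomial coefficients. -/
def oddPair (a : ℚ) (k : ℕ) : ℚ :=
  ∏ j ∈ range k, ((j + 1 : ℚ) ^ 2 - a ^ 2) / (j + 1) ^ 2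

theorem binomPair_succ (a : ℚ) (k : ℕ) :
    binomPair a (k + 1) = binomPair a k * ((a - k) * (-1 - a - k) / (k + 1) ^ 2) := by
  have : (k : ℚ) + 1 ≠ 0 := by positivity
  simp only [binomPair, prod_range_succ]
  field_simp

theorem oddPair_succ (a : ℚ) (k : ℕ) :
    oddPair a (k + 1) = oddPair a k * (((k + 1 : ℚ) ^ 2 - a ^ 2) / (k + 1) ^ 2) := by
  simp only [oddPair, prod_range_succ]

theorem harm_succ (k : ℕ) : harm (k + 1) = harm k + 1 / (k + 1) := by
  simp only [harm, sum_range_succ]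

theorem binomPair_mul_sub (a : ℚ) (k : ℕ) :
    binomPair a k * (a - k) = oddPair a k * a := by
  induction k with
  | zero => simp [binomPair, oddPair]
  | succ k ih =>
    rw [binomPair_succ, oddPair_succ]
    push_cast
    linear_combination ((-1 - a - k) * (a - (k + 1)) / (k + 1) ^ 2) * ih

theorem binomPair_pred_mul_add (a : ℚ) (k : ℕ) :
    binomPair (a - 1) k * (a + k) = oddPair a k * a := by
  induction k with
  | zero => simp [binomPair, oddPair]
  | succ k ih =>
    rw [binomPair_succ, oddPair_succ]
    push_cast
    linear_combination (-(a - 1 - k) * (a + (k + 1)) / (k + 1) ^ 2) * ih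

theorem binomPair_succ_eq (a : ℚ) (k : ℕ) :
    binomPair a (k + 1) = oddPair a k * (a * (-1 - a - k) / (k + 1) ^ 2) := by
  rw [binomPair_succ]
  linear_combination ((-1 - a - k) / (k + 1) ^ 2) * binomPair_mul_sub a k

theorem binomPair_add_pred (a : ℚ) (k : ℕ) :
    binomPair a (k + 1) + binomPair (a - 1) (k + 1) =
      2 * (oddPair a (k + 1) - oddPair a k) := by
  have : (k : ℚ) + 1 ≠ 0 := by positivity
  have h1 : binomPair (a - 1) (k + 1) = oddPair a k * (a * (-(a - 1 - k)) / (k + 1) ^ 2) := by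
    rw [binomPair_succ]
    linear_combination (-(a - 1 - k) / (k + 1) ^ 2) * binomPair_pred_mul_add a k
  rw [binomPair_succ_eq, h1, oddPair_succ]
  field_simp
  ring

theorem sum_binomPair_harm_add_pred (a : ℚ) (N : ℕ) :
    ∑ k ∈ range (N + 1), binomPair a k * harm k +
      ∑ k ∈ range (N + 1), binomPair (a - 1) k * harm k =
      2 * (oddPair a N * harm N - ∑ k ∈ range N, oddPair a k / (k + 1)) := by
  induction N with
  | zero => simp [harm]
  | succ N ih =>
    rw [sum_range_succ _ (N + 1), sum_range_succ _ (N + 1),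
      sum_range_succ (fun k => oddPair a k / ((k : ℚ) + 1)), harm_succ]
    linear_combination ih + (harm N + 1 / (N + 1)) * binomPair_add_pred a N

theorem sum_binomPair_div (a : ℚ) (N : ℕ) :
    a * (a - 1) * ∑ k ∈ range N, binomPair (a - 1) k / (k + 1) =
      -(N * binomPair (a - 1) N) := by
  induction N with
  | zero => simp
  | succ N ih =>
    have : (N : ℚ) + 1 ≠ 0 := by positivity
    rw [sum_range_succ, mul_add, ih, binomPair_succ]
    push_cast
    field_simp
    ring

theorem sum_oddPair_add_pred (a : ℚ) (N : ℕ) :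
    a * (a - 1) * (a * ∑ k ∈ range N, oddPair a k / (k + 1) +
      (a - 1) * ∑ k ∈ range N, oddPair (a - 1) k / (k + 1)) =
      -((2 * a - 1) * N * binomPair (a - 1) N) := by
  have h : a * ∑ k ∈ range N, oddPair a k / (k + 1) +
      (a - 1) * ∑ k ∈ range N, oddPair (a - 1) k / (k + 1) =
      (2 * a - 1) * ∑ k ∈ range N, binomPair (a - 1) k / (k + 1) := by
    rw [mul_sum, mul_sum, mul_sum, ← sum_add_distrib]
    refine sum_congr rfl fun k _ => ?_
    linear_combination (-1 / (k + 1 : ℚ)) * binomPair_pred_mul_add a k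
      - 1 / (k + 1) * binomPair_mul_sub (a - 1) k
  rw [h]
  linear_combination (2 * a - 1) * sum_binomPair_div a N

theorem two_mul_sum_harm_div (N : ℕ) :
    2 * ∑ k ∈ range N, harm (k + 1) / (k + 1) = harm N ^ 2 + harm2 N := by
  induction N with
  | zero => simp [harm, harm2]
  | succ N ih =>
    have h2 : harm2 (N + 1) = harm2 N + 1 / (N + 1) ^ 2 := by
      simp only [harm2, sum_range_succ]
    have : (N : ℚ) + 1 ≠ 0 := by positivity
    rw [sum_range_succ, mul_add, ih, h2, harm_succ]
    field_simp
    ring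

theorem choose_mul_choose_div_eq_binomPair (k : ℕ) :
    (Nat.choose (6 * k) (3 * k) : ℚ) * (Nat.choose (3 * k) k) / 432 ^ k =
      binomPair (-1 / 6) k := by
  have h1 : ∀ k : ℕ, (Nat.choose (6 * k) (3 * k) : ℚ) * (Nat.choose (3 * k) k) =
      (6 * k).factorial / ((3 * k).factorial * k.factorial * (2 * k).factorial) := by
    intro k
    have e1 := Nat.choose_mul_factorial_mul_factorial (show 3 * k ≤ 6 * k by omega)
    have e2 := Nat.choose_mul_factorial_mul_factorial (show k ≤ 3 * k by omega)
    rw [show 6 * k - 3 * k = 3 * k by omega] at e1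
    rw [show 3 * k - k = 2 * k by omega] at e2
    rw [eq_div_iff (by positivity)]
    have e1' : ((6 * k).choose (3 * k) : ℚ) * (3 * k).factorial * (3 * k).factorial =
      (6 * k).factorial := by exact_mod_cast e1
    have e2' : ((3 * k).choose k : ℚ) * k.factorial * (2 * k).factorial =
      (3 * k).factorial := by exact_mod_cast e2
    rw [← e1']
    linear_combination ((6 * k).choose (3 * k) : ℚ) * (3 * k).factorial * e2'
  rw [h1]
  induction k with
  | zero => simp [binomPair]
  | succ k ih =>
    rw [binomPair_succ, ← ih]
    have e6 : 6 * (k + 1) = 6 * k + 1 + 1 + 1 + 1 + 1 + 1 := by ring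
    have e3 : 3 * (k + 1) = 3 * k + 1 + 1 + 1 := by ring
    have e2 : 2 * (k + 1) = 2 * k + 1 + 1 := by ring
    rw [e6, e3, e2]
    simp only [Nat.factorial_succ]
    push_cast
    have a1 : (k : ℚ) + 1 ≠ 0 := by positivity
    field_simp
    ring

theorem binomPair_symm (a : ℚ) (k : ℕ) : binomPair (-1 - a) k = binomPair a k := by
  unfold binomPair
  rw [mul_comm]
  congr 2
  ext j
  ring

theorem PDiv.inv_two {p : ℕ} (hp3 : 3 < p) : PDiv p 0 ((2 : ℚ)⁻¹) := by
  simpa using PDiv.inv_nat (p := p) (z := 2) (by omega) (by omega)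

theorem PDiv.of_mul_self {p : ℕ} (hp : p.Prime) {m : ℕ} {x : ℚ} (h : PDiv p (m + 1) (p * x)) :
    PDiv p m x := by
  obtain ⟨a, b, hb, h⟩ := h
  have hp0 : (p : ℚ) ≠ 0 := by exact_mod_cast hp.ne_zero
  exact ⟨a, b, hb, mul_left_cancel₀ hp0 (by rw [← mul_assoc, h, pow_succ]; ring)⟩

theorem PDiv.mul_self {p : ℕ} (hp : p.Prime) {m : ℕ} {x : ℚ} (h : PDiv p m x) :
    PDiv p (m + 1) (p * x) := by
  rw [mul_comm]
  exact h.mul hp (self hp)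

theorem not_dvd_six {p : ℕ} (hp : p.Prime) (hp3 : 3 < p) : ¬ p ∣ 6 := by
  intro h
  rw [show 6 = 2 * 3 by norm_num, hp.dvd_mul] at h
  rcases h with h | h
  · exact absurd (Nat.le_of_dvd (by norm_num) h) (by omega)
  · exact absurd (Nat.le_of_dvd (by norm_num) h) (by omega)

theorem mod_six_of_prime {p : ℕ} (hp : p.Prime) (hp3 : 3 < p) : p % 6 = 1 ∨ p % 6 = 5 := by
  have h2 : ¬ 2 ∣ p := fun h => by
    have := (Nat.prime_dvd_prime_iff_eq Nat.prime_two hp).mp h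
    omega
  have h3 : ¬ 3 ∣ p := fun h => by
    have := (Nat.prime_dvd_prime_iff_eq Nat.prime_three hp).mp h
    omega
  omega

section Scaling

variable {p d : ℕ} {x : ℕ → ℕ}

theorem injOn_scaling (hd : ∀ m, d ∣ m + x m * p) :
    Set.InjOn (fun m => (m + x m * p) / d) (Ico 1 p : Finset ℕ) := by
  intro m hm k hk h
  simp only [coe_Ico, Set.mem_Ico] at hm hk
  have h' : m + x m * p = k + x k * p := by
    rw [← Nat.mul_div_cancel' (hd m), ← Nat.mul_div_cancel' (hd k)]
    exact congrArg (d * ·) h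
  have := congrArg (· % p) h'
  simpa [Nat.add_mul_mod_self_right, Nat.mod_eq_of_lt hm.2, Nat.mod_eq_of_lt hk.2] using this

theorem scaling_mem (hx : ∀ m, x m < d) (hd : ∀ m, d ∣ m + x m * p) {m : ℕ}
    (hm : m ∈ Ico 1 p) : (m + x m * p) / d ∈ Ico 1 p := by
  rw [mem_Ico] at hm ⊢
  have hd0 : 0 < d := lt_of_le_of_lt (Nat.zero_le _) (hx 0)
  refine ⟨Nat.div_pos (Nat.le_of_dvd (by omega) (hd m)) hd0, ?_⟩
  rw [Nat.div_lt_iff_lt_mul hd0]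
  calc m + x m * p < p + x m * p := by omega
    _ = (x m + 1) * p := by ring
    _ ≤ d * p := Nat.mul_le_mul_right _ (hx m)
    _ = p * d := mul_comm _ _

theorem image_scaling (hx : ∀ m, x m < d) (hd : ∀ m, d ∣ m + x m * p) :
    (Ico 1 p).image (fun m => (m + x m * p) / d) = Ico 1 p := by
  apply Finset.eq_of_subset_of_card_le
  · intro k hk
    obtain ⟨m, hm, rfl⟩ := mem_image.mp hk
    exact scaling_mem hx hd hm
  · rw [card_image_of_injOn (injOn_scaling hd)]

theorem cast_scaling (hx : ∀ m, x m < d) (hd : ∀ m, d ∣ m + x m * p) (m : ℕ) :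
    (((m + x m * p) / d : ℕ) : ℚ) = (m + x m * p) / d := by
  have hd0 : (d : ℚ) ≠ 0 := by
    have := lt_of_le_of_lt (Nat.zero_le _) (hx 0)
    positivity
  rw [Nat.cast_div (hd m) hd0]
  push_cast
  ring

theorem pow_eq_prod_scaling (hx : ∀ m, x m < d) (hd : ∀ m, d ∣ m + x m * p) :
    (d : ℚ) ^ (p - 1) = ∏ m ∈ Ico 1 p, (1 + p * ((x m : ℚ) / m)) := by
  have hd0 : (d : ℚ) ≠ 0 := by
    have := lt_of_le_of_lt (Nat.zero_le _) (hx 0)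
    positivity
  have h1 : ∏ m ∈ Ico 1 p, (m : ℚ) = ∏ m ∈ Ico 1 p, (((m : ℚ) + x m * p) / d) := by
    conv_lhs => rw [← image_scaling hx hd, prod_image (injOn_scaling hd)]
    exact prod_congr rfl fun m _ => cast_scaling hx hd m
  have h2 : ∏ m ∈ Ico 1 p, (((m : ℚ) + x m * p) / d) =
      (∏ m ∈ Ico 1 p, (m : ℚ)) * (∏ m ∈ Ico 1 p, (1 + p * ((x m : ℚ) / m))) /
        (d : ℚ) ^ (p - 1) := by
    rw [prod_div_distrib, prod_const, Nat.card_Ico, ← prod_mul_distrib]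
    congr 1
    refine prod_congr rfl fun m hm => ?_
    have : (m : ℚ) ≠ 0 := by
      have := (mem_Ico.mp hm).1
      positivity
    field_simp
  have h3 : ∏ m ∈ Ico 1 p, (m : ℚ) ≠ 0 := prod_ne_zero_iff.mpr fun m hm => by
    have := (mem_Ico.mp hm).1
    positivity
  rw [h2, eq_div_iff (by positivity)] at h1
  exact mul_left_cancel₀ h3 h1

theorem PDiv.prod_one_add (hp : p.Prime) {ι : Type*} (s : Finset ι) {y : ι → ℚ}
    (hy : ∀ i ∈ s, PDiv p 0 (y i)) :
    PDiv p 3 (2 * (∏ i ∈ s, (1 + p * y i) - 1 - p * ∑ i ∈ s, y i) -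
      p ^ 2 * ((∑ i ∈ s, y i) ^ 2 - ∑ i ∈ s, y i ^ 2)) := by
  classical
  induction s using Finset.induction_on with
  | empty => simpa using PDiv.zero hp 3
  | insert a s ha ih =>
    have hs : ∀ i ∈ s, PDiv p 0 (y i) := fun i hi => hy i (mem_insert_of_mem hi)
    have hya := hy a (mem_insert_self a s)
    have hA : PDiv p 0 (∑ i ∈ s, y i) := PDiv.sum hp s hs
    have hS : PDiv p 0 (∑ i ∈ s, y i ^ 2) := PDiv.sum hp s fun i hi => by
      rw [pow_two]
      exact (hs i hi).mul hp (hs i hi)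
    have hB : PDiv p 0 ((∑ i ∈ s, y i) ^ 2 - ∑ i ∈ s, y i ^ 2) := by
      refine PDiv.sub hp ?_ hS
      rw [pow_two]
      exact hA.mul hp hA
    have h1 : PDiv p 0 (1 + p * y a) := by
      have := (PDiv.int hp 1).add hp ((PDiv.nat hp p).mul hp hya)
      simpa using this
    have h2 := (((hya.mul hp hB).mul_self hp).mul_self hp).mul_self hp
    have h3 := (h1.mulLeft hp (ih hs)).add hp h2
    rw [prod_insert ha, sum_insert ha, sum_insert ha]
    convert h3 using 1
    ring

end Scaling

/-- The Fermat quotient of `d`. -/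
def fermatQuot (p d : ℕ) : ℚ := ((d : ℚ) ^ (p - 1) - 1) / p

/-- The logarithm of `d ^ (p - 1)` divided by `p`, truncated modulo `p ^ 2`. -/
def fermatLog (p d : ℕ) : ℚ := fermatQuot p d - p / 2 * fermatQuot p d ^ 2

section Fermat

variable {p d : ℕ} {x : ℕ → ℕ}

theorem fermatQuot_spec (hp : p.Prime) (hp3 : 3 < p) (hx : ∀ m, x m < d)
    (hd : ∀ m, d ∣ m + x m * p) :
    PDiv p 0 (fermatQuot p d) ∧
    PDiv p 2 (fermatLog p d - (∑ m ∈ Ico 1 p, (x m : ℚ) * (1 / m) -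
      p / 2 * ∑ m ∈ Ico 1 p, (x m : ℚ) ^ 2 * (1 / m ^ 2))) := by
  have hp0 : (p : ℚ) ≠ 0 := by exact_mod_cast hp.ne_zero
  have hy : ∀ m ∈ Ico 1 p, PDiv p 0 ((x m : ℚ) / m) := fun m hm => by
    rw [mem_Ico] at hm
    exact (PDiv.nat hp _).mul hp (PDiv.inv_nat (by omega) hm.2)
  have e1 : ∑ m ∈ Ico 1 p, (x m : ℚ) * (1 / m) = ∑ m ∈ Ico 1 p, (x m : ℚ) / m :=
    sum_congr rfl fun m _ => by ring
  have e2 : ∑ m ∈ Ico 1 p, (x m : ℚ) ^ 2 * (1 / m ^ 2) = ∑ m ∈ Ico 1 p, ((x m : ℚ) / m) ^ 2 :=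
    sum_congr rfl fun m _ => by rw [div_pow]; ring
  have hA : PDiv p 0 (∑ m ∈ Ico 1 p, (x m : ℚ) / m) := PDiv.sum hp _ hy
  have hS : PDiv p 0 (∑ m ∈ Ico 1 p, ((x m : ℚ) / m) ^ 2) := PDiv.sum hp _ fun i hi => by
    rw [pow_two]
    exact (hy i hi).mul hp (hy i hi)
  have h := PDiv.prod_one_add hp _ hy
  rw [← pow_eq_prod_scaling hx hd] at h
  rw [e1, e2]
  have hq : (d : ℚ) ^ (p - 1) = 1 + p * fermatQuot p d := by
    unfold fermatQuot
    field_simp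
    ring
  rw [hq] at h
  unfold fermatLog
  generalize fermatQuot p d = q at *
  generalize (∑ m ∈ Ico 1 p, (x m : ℚ) / m) = A at *
  generalize (∑ m ∈ Ico 1 p, ((x m : ℚ) / m) ^ 2) = S at *
  have h2 : PDiv p 2 (q - A - p * (2⁻¹ * (A ^ 2 - S))) := by
    apply PDiv.of_mul_self hp
    convert (PDiv.inv_two hp3).mulLeft hp h using 1
    ring
  have hAS : PDiv p 0 (2⁻¹ * (A ^ 2 - S)) := by
    refine (PDiv.inv_two hp3).mulLeft hp (PDiv.sub hp ?_ hS)
    rw [pow_two]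
    exact hA.mul hp hA
  have h1 : PDiv p 1 (q - A) := by
    convert (h2.mono (by norm_num : 1 ≤ 2)).add hp (hAS.mul_self hp) using 1
    ring
  have hq0 : PDiv p 0 q := by
    convert (h1.mono (by norm_num : 0 ≤ 1)).add hp hA using 1
    ring
  refine ⟨hq0, ?_⟩
  have h3 : PDiv p 2 (p * (2⁻¹ * ((q - A) * (q + A)))) :=
    ((PDiv.inv_two hp3).mulLeft hp (h1.mulRight hp (hq0.add hp hA))).mul_self hp
  convert h2.sub hp h3 using 1
  ring

theorem fermatLog_mul (hp : p.Prime) (hp3 : 3 < p) {c : ℕ} (hc : PDiv p 0 (fermatQuot p c))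
    (hd : PDiv p 0 (fermatQuot p d)) :
    PDiv p 2 (fermatLog p (c * d) - fermatLog p c - fermatLog p d) := by
  have hp0 : (p : ℚ) ≠ 0 := by exact_mod_cast hp.ne_zero
  have hq : fermatQuot p (c * d) =
      fermatQuot p c + fermatQuot p d + p * (fermatQuot p c * fermatQuot p d) := by
    unfold fermatQuot
    push_cast
    rw [mul_pow]
    field_simp
    ring
  unfold fermatLog
  rw [hq]
  generalize fermatQuot p c = a at *
  generalize fermatQuot p d = b at *
  have h : PDiv p 0 (-(2⁻¹ * (a * b * ((2 : ℤ) * (a + b) + p * (a * b))))) :=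
    ((PDiv.inv_two hp3).mul hp ((hc.mul hp hd).mul hp
      (((PDiv.int hp 2).mul hp (hc.add hp hd)).add hp
        ((PDiv.nat hp p).mul hp (hc.mul hp hd))))).neg hp
  convert (h.mul_self hp).mul_self hp using 1
  push_cast
  ring

end Fermat

/-- The sum of `f m` over the `m` in `[1, p)` with `m * p ≡ i (mod 6)`. -/
def classSum (p i : ℕ) (f : ℕ → ℚ) : ℚ := ∑ m ∈ Ico 1 p with m * p % 6 = i, f m

section Classes

variable {p : ℕ}

theorem sum_class_mul (w : ℕ → ℚ) (f : ℕ → ℚ) :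
    ∑ m ∈ Ico 1 p, w (m * p % 6) * f m = ∑ i ∈ range 6, w i * classSum p i f := by
  rw [← sum_fiberwise_of_maps_to (t := range 6) (g := fun m => m * p % 6)
    (fun m _ => mem_range.mpr (Nat.mod_lt _ (by norm_num)))]
  refine sum_congr rfl fun i _ => ?_
  rw [classSum, mul_sum]
  refine sum_congr rfl fun m hm => ?_
  rw [(mem_filter.mp hm).2]

theorem classSum_reflect (hp6 : p % 6 = 1 ∨ p % 6 = 5) {i j : ℕ} (hi : i < 6) (hj : j < 6)
    (hij : (i + j) % 6 = 1) (f : ℕ → ℚ) :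
    classSum p j f = classSum p i fun m => f (p - m) := by
  have hpp : p * p % 6 = 1 := by
    rcases hp6 with h | h <;> simp [Nat.mul_mod, h]
  have key : ∀ m ∈ Ico 1 p, (p - m) * p + m * p = p * p := fun m hm => by
    rw [← add_mul, Nat.sub_add_cancel (mem_Ico.mp hm).2.le]
  unfold classSum
  refine sum_nbij' (fun m => p - m) (fun m => p - m) ?_ ?_ ?_ ?_ ?_
  · intro m hm
    rw [mem_filter] at hm ⊢
    have := key m hm.1
    have h1 := mem_Ico.mp hm.1
    exact ⟨mem_Ico.mpr (by omega), by omega⟩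
  · intro m hm
    rw [mem_filter] at hm ⊢
    have := key m hm.1
    have h1 := mem_Ico.mp hm.1
    exact ⟨mem_Ico.mpr (by omega), by omega⟩
  · intro m hm
    have h1 := mem_Ico.mp (mem_filter.mp hm).1
    omega
  · intro m hm
    have h1 := mem_Ico.mp (mem_filter.mp hm).1
    omega
  · intro m hm
    have h1 := mem_Ico.mp (mem_filter.mp hm).1
    congr 1
    omega

theorem classSum_reflect_inv (hp : p.Prime) (hp6 : p % 6 = 1 ∨ p % 6 = 5) {i j : ℕ} (hi : i < 6)
    (hj : j < 6) (hij : (i + j) % 6 = 1) :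
    PDiv p 2 (classSum p j (fun m => 1 / m) + classSum p i (fun m => 1 / m) +
      p * classSum p i (fun m => 1 / m ^ 2)) := by
  rw [classSum_reflect hp6 hi hj hij]
  unfold classSum
  rw [mul_sum, ← sum_add_distrib, ← sum_add_distrib]
  refine PDiv.sum hp _ fun m hm => ?_
  have h1 := mem_Ico.mp (mem_filter.mp hm).1
  have hm := PDiv.inv_nat (p := p) (z := m) (by omega) (by omega)
  have hm' := PDiv.inv_nat (p := p) (z := p - m) (by omega) (by omega)
  have n1 : (m : ℚ) ≠ 0 := by
    have := h1.1
    positivity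
  have n2 : (p : ℚ) - m ≠ 0 := sub_ne_zero.mpr (by exact_mod_cast h1.2.ne')
  rw [Nat.cast_sub h1.2.le] at hm' ⊢
  convert (((hm.mul hp hm).mul hp hm').mul_self hp).mul_self hp using 1
  field_simp
  ring

theorem classSum_reflect_inv_sq (hp : p.Prime) (hp6 : p % 6 = 1 ∨ p % 6 = 5) {i j : ℕ}
    (hi : i < 6) (hj : j < 6) (hij : (i + j) % 6 = 1) :
    PDiv p 1 (classSum p j (fun m => 1 / m ^ 2) - classSum p i (fun m => 1 / m ^ 2)) := by
  rw [classSum_reflect hp6 hi hj hij]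
  unfold classSum
  rw [← sum_sub_distrib]
  refine PDiv.sum hp _ fun m hm => ?_
  have h1 := mem_Ico.mp (mem_filter.mp hm).1
  have hm := PDiv.inv_nat (p := p) (z := m) (by omega) (by omega)
  have hm' := PDiv.inv_nat (p := p) (z := p - m) (by omega) (by omega)
  have n1 : (m : ℚ) ≠ 0 := by
    have := h1.1
    positivity
  have n2 : (p : ℚ) - m ≠ 0 := sub_ne_zero.mpr (by exact_mod_cast h1.2.ne')
  have h2 := PDiv.int hp (2 * m - p)
  rw [Nat.cast_sub h1.2.le] at hm' ⊢
  convert (h2.mul hp (((hm.mul hp hm).mul hp hm').mul hp hm')).mul_self hp using 1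
  push_cast
  field_simp
  ring

theorem dvd_class_scaling (hp6 : p % 6 = 1 ∨ p % 6 = 5) {d : ℕ} (hd : d = 2 ∨ d = 3 ∨ d = 6)
    (m : ℕ) : d ∣ m + ((d - 1) * (m * p % 6) % d) * p := by
  obtain ⟨n, r, rfl, hr⟩ : ∃ n r, p = 6 * n + r ∧ (r = 1 ∨ r = 5) :=
    ⟨p / 6, p % 6, by omega, hp6⟩
  have h1 : m * (6 * n + r) = 6 * (m * n) + m * r := by ring
  generalize hx : (d - 1) * (m * (6 * n + r) % 6) % d = x
  have h2 : x * (6 * n + r) = 6 * (x * n) + x * r := by ring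
  rw [h1] at hx
  rw [h2]
  rcases hr with rfl | rfl <;> rcases hd with rfl | rfl | rfl <;> norm_num at hx ⊢ <;> omega

theorem fermatLog_classSum (hp : p.Prime) (hp3 : 3 < p) {d : ℕ} (hd : d = 2 ∨ d = 3 ∨ d = 6) :
    PDiv p 0 (fermatQuot p d) ∧
    PDiv p 2 (fermatLog p d -
      (∑ i ∈ range 6, (((d - 1) * i % d : ℕ) : ℚ) * classSum p i (fun m => 1 / m) -
        p / 2 * ∑ i ∈ range 6, (((d - 1) * i % d : ℕ) : ℚ) ^ 2 *
          classSum p i (fun m => 1 / m ^ 2))) := by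
  rw [← sum_class_mul (fun i => (((d - 1) * i % d : ℕ) : ℚ)),
    ← sum_class_mul (fun i => (((d - 1) * i % d : ℕ) : ℚ) ^ 2)]
  exact fermatQuot_spec hp hp3 (fun m => Nat.mod_lt _ (by omega))
    (dvd_class_scaling (mod_six_of_prime hp hp3) hd)

theorem sum_inv_sq (hp : p.Prime) (hp3 : 3 < p) :
    PDiv p 1 (∑ m ∈ Ico 1 p, (1 : ℚ) / m ^ 2) := by
  have hp6 := mod_six_of_prime hp hp3
  let x : ℕ → ℕ := fun m => (2 - 1) * (m * p % 6) % 2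
  have hx : ∀ m, x m < 2 := fun m => Nat.mod_lt _ (by norm_num)
  have hd : ∀ m, 2 ∣ m + x m * p := dvd_class_scaling hp6 (Or.inl rfl)
  have h1 : ∑ m ∈ Ico 1 p, (1 : ℚ) / m ^ 2 =
      ∑ m ∈ Ico 1 p, (1 : ℚ) / (((m + x m * p) / 2 : ℕ) : ℚ) ^ 2 := by
    conv_lhs => rw [← image_scaling hx hd, sum_image (injOn_scaling hd)]
  have h2 : PDiv p 1 (∑ m ∈ Ico 1 p, ((1 : ℚ) / (((m + x m * p) / 2 : ℕ) : ℚ) ^ 2 -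
      4 * (1 / m ^ 2))) := by
    refine PDiv.sum hp _ fun m hm => ?_
    have h3 := mem_Ico.mp hm
    have h4 := mem_Ico.mp (scaling_mem hx hd hm)
    have i1 := PDiv.inv_nat (p := p) (z := m) (by omega) (by omega)
    have i2 := PDiv.inv_nat (p := p) h4.1 h4.2
    have n1 : (m : ℚ) ≠ 0 := by
      have := h3.1
      positivity
    have n2 : (((m + x m * p) / 2 : ℕ) : ℚ) ≠ 0 := by
      have := h4.1
      positivity
    have e := cast_scaling hx hd m
    generalize (((m + x m * p) / 2 : ℕ) : ℚ) = y at *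
    push_cast at e
    have i3 := (PDiv.nat hp (x m)).mul hp
      ((PDiv.nat hp (2 * m)).add hp (PDiv.nat hp (x m * p)))
    convert (i3.mul hp (((i1.mul hp i1).mul hp i2).mul hp i2)).neg hp |>.mul_self hp using 1
    push_cast
    have e' : (m : ℚ) = 2 * y - x m * p := by linarith
    field_simp
    rw [e']
    ring
  rw [sum_sub_distrib, ← h1, ← mul_sum] at h2
  have i3 := PDiv.inv_nat (p := p) (z := 3) (by omega) (by omega)
  convert (i3.mulLeft hp h2).neg hp using 1
  push_cast
  ring

theorem sum_classSum (f : ℕ → ℚ) :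
    ∑ m ∈ Ico 1 p, f m = ∑ i ∈ range 6, classSum p i f := by
  simpa using sum_class_mul (p := p) (fun _ => 1) f

theorem classSum_sq_odd (hp : p.Prime) (hp3 : 3 < p) :
    PDiv p 1 (classSum p 1 (fun m => 1 / m ^ 2) + classSum p 3 (fun m => 1 / m ^ 2) +
      classSum p 5 (fun m => 1 / m ^ 2)) := by
  have hp6 := mod_six_of_prime hp hp3
  have t1 := classSum_reflect_inv_sq hp hp6 (i := 1) (j := 0) (by omega) (by omega) (by omega)
  have t2 := classSum_reflect_inv_sq hp hp6 (i := 5) (j := 2) (by omega) (by omega) (by omega)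
  have t3 := classSum_reflect_inv_sq hp hp6 (i := 3) (j := 4) (by omega) (by omega) (by omega)
  have h := sum_inv_sq hp hp3
  rw [sum_classSum] at h
  simp only [sum_range_succ, sum_range_zero] at h
  convert (PDiv.inv_two hp3).mulLeft hp (((h.sub hp t1).sub hp t2).sub hp t3) using 1
  ring

theorem sum_inv (hp : p.Prime) (hp3 : 3 < p) : PDiv p 2 (∑ m ∈ Ico 1 p, (1 : ℚ) / m) := by
  have hp6 := mod_six_of_prime hp hp3
  have r1 := classSum_reflect_inv hp hp6 (i := 1) (j := 0) (by omega) (by omega) (by omega)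
  have r2 := classSum_reflect_inv hp hp6 (i := 5) (j := 2) (by omega) (by omega) (by omega)
  have r3 := classSum_reflect_inv hp hp6 (i := 3) (j := 4) (by omega) (by omega) (by omega)
  have h := (classSum_sq_odd hp hp3).mul_self hp
  rw [sum_classSum]
  simp only [sum_range_succ, sum_range_zero]
  convert ((r1.add hp r2).add hp r3).sub hp h using 1
  ring

theorem twelve_mul_classSum_one (hp : p.Prime) (hp3 : 3 < p) :
    PDiv p 2 (12 * classSum p 1 (fun m => 1 / m) - 3 * fermatLog p 3 - 4 * fermatLog p 2) := by
  have hp6 := mod_six_of_prime hp hp3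
  have r2 := classSum_reflect_inv hp hp6 (i := 5) (j := 2) (by omega) (by omega) (by omega)
  have r3 := classSum_reflect_inv hp hp6 (i := 3) (j := 4) (by omega) (by omega) (by omega)
  have t2 := classSum_reflect_inv_sq hp hp6 (i := 5) (j := 2) (by omega) (by omega) (by omega)
  have t3 := classSum_reflect_inv_sq hp hp6 (i := 3) (j := 4) (by omega) (by omega) (by omega)
  have S := classSum_sq_odd hp hp3
  obtain ⟨q2, L2⟩ := fermatLog_classSum hp hp3 (d := 2) (by simp)
  obtain ⟨q3, L3⟩ := fermatLog_classSum hp hp3 (d := 3) (by simp)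
  obtain ⟨-, L6⟩ := fermatLog_classSum hp hp3 (d := 6) (by simp)
  have M := fermatLog_mul hp hp3 q2 q3
  norm_num only at M
  simp only [sum_range_succ, sum_range_zero] at L2 L3 L6
  norm_num only at L2 L3 L6
  have hn := PDiv.nat hp
  have T := ((((hn 9).mulLeft hp t2).add hp ((hn 6).mulLeft hp t3)).add hp
    ((hn 18).mulLeft hp S)).mul_self hp
  have L := (((hn 3).mulLeft hp L2).add hp ((hn 2).mulLeft hp L3)).add hp L6
  have R := (hn 6).mulLeft hp (r2.add hp r3)
  convert ((M.add hp T).sub hp L).sub hp R using 1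
  push_cast
  ring

end Classes

section Main

variable {p : ℕ}

theorem harm_eq_sum_Ico (k : ℕ) : harm k = ∑ m ∈ Ico 1 (k + 1), (1 : ℚ) / m := by
  rw [sum_Ico_eq_sum_range, harm]
  refine sum_congr (by simp) fun i _ => ?_
  push_cast
  rw [add_comm]

theorem harm2_eq_sum_Ico (k : ℕ) : harm2 k = ∑ m ∈ Ico 1 (k + 1), (1 : ℚ) / m ^ 2 := by
  rw [sum_Ico_eq_sum_range, harm2]
  refine sum_congr (by simp) fun i _ => ?_
  push_cast
  rw [add_comm]

theorem PDiv.harm_pred (hp : p.Prime) (hp3 : 3 < p) : PDiv p 2 (harm (p - 1)) := by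
  rw [harm_eq_sum_Ico, Nat.sub_add_cancel hp.one_le]
  exact sum_inv hp hp3

theorem PDiv.harm2_pred (hp : p.Prime) (hp3 : 3 < p) : PDiv p 1 (harm2 (p - 1)) := by
  rw [harm2_eq_sum_Ico, Nat.sub_add_cancel hp.one_le]
  exact sum_inv_sq hp hp3

theorem PDiv.inv_succ {k : ℕ} (hk : k + 1 < p) : PDiv p 0 (((k : ℚ) + 1)⁻¹) := by
  simpa using PDiv.inv_nat (p := p) (z := k + 1) (by omega) hk

theorem PDiv.harm_of_lt (hp : p.Prime) {k : ℕ} (hk : k < p) : PDiv p 0 (harm k) := by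
  refine PDiv.sum hp _ fun j hj => ?_
  rw [one_div]
  exact PDiv.inv_succ (by have := mem_range.mp hj; omega)

theorem PDiv.oddPair_of_lt (hp : p.Prime) {a : ℚ} (ha : PDiv p 0 a) {k : ℕ} (hk : k < p) :
    PDiv p 0 (oddPair a k) := by
  refine PDiv.prod hp _ fun j hj => ?_
  have hi := PDiv.inv_succ (p := p) (k := j) (by have := mem_range.mp hj; omega)
  have h := (((PDiv.nat hp (j + 1)).mul hp (PDiv.nat hp (j + 1))).sub hp (ha.mul hp ha)).mul hp
    (hi.mul hp hi)
  convert h using 1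
  push_cast
  rw [div_eq_mul_inv, pow_two, pow_two, mul_inv]

theorem PDiv.oddPair_sub_one (hp : p.Prime) {t : ℚ} (ht : PDiv p 1 t) {k : ℕ} (hk : k < p) :
    PDiv p 1 (oddPair t k - 1) := by
  have ht0 := ht.mono (Nat.zero_le 1)
  induction k with
  | zero => simpa [oddPair] using PDiv.zero hp 1
  | succ k ih =>
    have hi := PDiv.inv_succ hk
    have h0 := PDiv.oddPair_of_lt hp ht0 (k := k) (by omega)
    have h1 := (ih (by omega)).sub hp
      (h0.mulLeft hp ((ht0.mulLeft hp ht).mulRight hp (hi.mul hp hi)))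
    have : (k : ℚ) + 1 ≠ 0 := by positivity
    convert h1 using 1
    rw [oddPair_succ]
    field_simp
    ring

theorem PDiv.sum_binomPair_harm_of_dvd (hp : p.Prime) (hp3 : 3 < p) {t : ℚ} (ht : PDiv p 1 t) :
    PDiv p 2 (∑ k ∈ range p, binomPair t k * harm k) := by
  have ht0 := ht.mono (Nat.zero_le 1)
  have hsplit : ∑ k ∈ range p, binomPair t k * harm k =
      ∑ k ∈ range (p - 1), binomPair t (k + 1) * harm (k + 1) := by
    conv_lhs => rw [← Nat.sub_add_cancel hp.one_le, sum_range_succ']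
    simp [harm]
  have h1 : PDiv p 2 (∑ k ∈ range (p - 1),
      (binomPair t (k + 1) * harm (k + 1) + t * (harm (k + 1) / (k + 1)))) := by
    refine PDiv.sum hp _ fun k hk => ?_
    have hk : k + 1 < p := by have := mem_range.mp hk; omega
    have hi := PDiv.inv_succ hk
    have h2 := (PDiv.oddPair_sub_one hp ht (k := k) (by omega)).mulRight hp
      (((PDiv.int hp (-1 - k)).sub hp ht0).mul hp (hi.mul hp hi))
    have h3 := ht.mulRight hp (hi.mul hp hi)
    have h4 := (ht.mul hp (h2.sub hp h3)).mulRight hp (PDiv.harm_of_lt hp hk)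
    have : (k : ℚ) + 1 ≠ 0 := by positivity
    convert h4 using 1
    rw [binomPair_succ_eq]
    push_cast
    field_simp
    ring
  have h2 : PDiv p 1 (∑ k ∈ range (p - 1), harm (k + 1) / ((k : ℚ) + 1)) := by
    have e := two_mul_sum_harm_div (p - 1)
    have hH := (PDiv.harm_pred hp hp3).mono (by norm_num : 1 ≤ 2)
    have h3 := (PDiv.inv_two hp3).mulLeft hp
      (((hH.mono (Nat.zero_le 1)).mulLeft hp hH).add hp (PDiv.harm2_pred hp hp3))
    convert h3 using 1
    linear_combination (1 / 2 : ℚ) * e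
  rw [hsplit]
  rw [sum_add_distrib, ← mul_sum] at h1
  convert h1.sub hp (ht.mul hp h2) using 1
  ring

theorem PDiv.oddPair_one_add (hp : p.Prime) {t : ℚ} (ht : PDiv p 1 t) {k : ℕ} (hk : k + 1 < p) :
    PDiv p 2 (oddPair (1 + t) (k + 1) + t * ((k + 2) / (k + 1))) := by
  have ht0 := ht.mono (Nat.zero_le 1)
  induction k with
  | zero =>
    convert (ht.mul hp ht).neg hp using 1
    norm_num [oddPair]
    ring
  | succ k ih =>
    have hi := PDiv.inv_succ hk
    have hi' := PDiv.inv_succ (p := p) (k := k) (by omega)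
    have hG := (((PDiv.nat hp (k + 1)).sub hp ht0).mul hp
      ((PDiv.nat hp (k + 3)).add hp ht0)).mul hp (hi.mul hp hi)
    have h1 := (ih (by omega)).mulRight hp hG
    have h2 := ht.mul hp (ht.mulRight hp
      (((PDiv.nat hp 2).add hp ht0).mul hp (hi.mul hp hi')))
    have n1 : (k : ℚ) + 1 ≠ 0 := by positivity
    have n2 : (k : ℚ) + 1 + 1 ≠ 0 := by positivity
    convert h1.add hp h2 using 1
    rw [oddPair_succ _ (k + 1)]
    push_cast
    field_simp
    ring

/-- The sum of `C(a, k + 1) * C(-1 - a, k)` over `k < N`. -/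
def shiftedSum (a : ℚ) (N : ℕ) : ℚ := a * ∑ k ∈ range N, oddPair a k / (k + 1)

theorem PDiv.shiftedSum_one_add (hp : p.Prime) (hp3 : 3 < p) {t : ℚ} (ht : PDiv p 1 t) :
    PDiv p 2 (shiftedSum (1 + t) (p - 1) - 1) := by
  have ht0 := ht.mono (Nat.zero_le 1)
  obtain ⟨M, rfl⟩ : ∃ M, p = M + 2 := ⟨p - 2, by omega⟩
  have hH := (PDiv.harm_pred hp hp3).mono (by norm_num : 1 ≤ 2)
  rw [show M + 2 - 1 = M + 1 by omega] at hH ⊢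
  have h1 : PDiv (M + 2) 2 (∑ k ∈ range M,
      (oddPair (1 + t) (k + 1) / (((k + 1 : ℕ) : ℚ) + 1) + t * (1 / (k + 1)))) := by
    refine PDiv.sum hp _ fun k hk => ?_
    have hk := mem_range.mp hk
    have hi := PDiv.inv_succ (p := M + 2) (k := k + 1) (by omega)
    have n1 : (k : ℚ) + 1 ≠ 0 := by positivity
    have n2 : (k : ℚ) + 1 + 1 ≠ 0 := by positivity
    convert (PDiv.oddPair_one_add hp ht (k := k) (by omega)).mulRight hp hi using 1
    push_cast
    field_simp
    ring
  have h2 : PDiv (M + 2) 1 (harm M - 1) := by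
    have hi := PDiv.inv_succ (p := M + 2) (k := M) (by omega)
    have n1 : (M : ℚ) + 1 ≠ 0 := by positivity
    convert hH.sub hp (hi.mul_self hp) using 1
    rw [harm_succ]
    push_cast
    field_simp
    ring
  have hh := PDiv.harm_of_lt hp (k := M) (by omega)
  rw [sum_add_distrib, ← mul_sum] at h1
  change PDiv (M + 2) 2 (_ + t * harm M) at h1
  rw [shiftedSum, sum_range_succ']
  have h3 := (((PDiv.nat hp 1).add hp ht0).mulLeft hp h1).sub hp (ht.mul hp h2)
  convert h3.sub hp (ht.mul hp (ht.mulRight hp hh)) using 1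
  simp [oddPair]
  ring

theorem PDiv.binomPair_pred (hp : p.Prime) {t : ℚ} (ht : PDiv p 1 t) {s : ℕ} (hs : 1 ≤ s)
    (hsp : s < p - 1) : PDiv p 2 (binomPair (s + t) (p - 1)) := by
  have ht0 := ht.mono (Nat.zero_le 1)
  have hi : ∀ j ∈ range (p - 1), PDiv p 0 (((j : ℚ) + 1)⁻¹) := fun j hj =>
    PDiv.inv_succ (by have := mem_range.mp hj; omega)
  have ha := (PDiv.nat hp s).add hp ht0
  refine PDiv.mul hp (m := 1) (k := 1) ?_ ?_
  · refine PDiv.prod_of_mem hp _ (fun j hj => ?_) (mem_range.mpr hsp) ?_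
    · exact (ha.sub hp (PDiv.nat hp j)).mul hp (hi j hj)
    · convert ht.mulRight hp (hi s (mem_range.mpr hsp)) using 1
      ring
  · have hmem : p - 1 - s ∈ range (p - 1) := mem_range.mpr (by omega)
    refine PDiv.prod_of_mem hp _ (fun j hj => ?_) hmem ?_
    · have h := (((PDiv.int hp (-1)).sub hp ha).sub hp (PDiv.nat hp j)).mul hp (hi j hj)
      simpa [div_eq_mul_inv] using h
    · convert (((PDiv.self hp).add hp ht).neg hp).mulRight hp (hi _ hmem) using 1
      rw [Nat.cast_sub hsp.le, Nat.cast_sub hp.one_le, div_eq_mul_inv]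
      push_cast
      ring

theorem PDiv.shiftedSum_succ_add (hp : p.Prime) (hp3 : 3 < p) {t : ℚ} (ht : PDiv p 1 t)
    (hinv : ∀ s : ℕ, 1 ≤ s → s < p → (s : ℚ) + t ≠ 0 ∧ PDiv p 0 (((s : ℚ) + t)⁻¹)) {j : ℕ}
    (hj : j < p - 1) :
    PDiv p 2 (shiftedSum ((j + 1 : ℕ) + t) (p - 1) - (-1) ^ j) := by
  have ht0 := ht.mono (Nat.zero_le 1)
  induction j with
  | zero => simpa using PDiv.shiftedSum_one_add hp hp3 ht
  | succ j ih =>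
    have hrec := sum_oddPair_add_pred (((j + 1 + 1 : ℕ) : ℚ) + t) (p - 1)
    have ea : ((j + 1 + 1 : ℕ) : ℚ) + t - 1 = ((j + 1 : ℕ) : ℚ) + t := by
      push_cast
      ring
    rw [ea] at hrec
    obtain ⟨n1, i1⟩ := hinv (j + 1) (by omega) (by omega)
    obtain ⟨n2, i2⟩ := hinv (j + 1 + 1) (by omega) (by omega)
    have hT := PDiv.binomPair_pred hp ht (s := j + 1) (by omega) hj
    have ha := (PDiv.nat hp (j + 1 + 1)).add hp ht0
    have ih := ih (by omega)
    change _ * _ * (shiftedSum _ _ + shiftedSum _ _) = _ at hrec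
    have hc := (((((PDiv.nat hp 2).mul hp ha).sub hp (PDiv.nat hp 1)).mul hp
      (PDiv.nat hp (p - 1))).mulLeft hp hT).neg hp
    generalize (((j + 1 + 1 : ℕ) : ℚ) + t) = a at *
    generalize (((j + 1 : ℕ) : ℚ) + t) = b at *
    have h1 : PDiv p 2 (shiftedSum a (p - 1) + shiftedSum b (p - 1)) := by
      convert (i2.mul hp i1).mulLeft hp hc using 1
      simp only [Nat.cast_ofNat, Nat.cast_one]
      rw [← hrec]
      field_simp
    convert h1.sub hp ih using 1
    ring

theorem PDiv.sum_binomPair_harm (hp : p.Prime) (hp3 : 3 < p) {t : ℚ} (ht : PDiv p 1 t)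
    (hinv : ∀ s : ℕ, 1 ≤ s → s < p → (s : ℚ) + t ≠ 0 ∧ PDiv p 0 (((s : ℚ) + t)⁻¹)) {s : ℕ}
    (hs : s < p) :
    PDiv p 2 (∑ k ∈ range p, binomPair (s + t) k * harm k -
      2 * (-1) ^ s * ∑ i ∈ range s, (((i + 1 : ℕ) : ℚ) + t)⁻¹) := by
  have ht0 := ht.mono (Nat.zero_le 1)
  induction s with
  | zero => simpa using PDiv.sum_binomPair_harm_of_dvd hp hp3 ht
  | succ s ih =>
    have hrec := sum_binomPair_harm_add_pred (((s + 1 : ℕ) : ℚ) + t) (p - 1)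
    have ea : ((s + 1 : ℕ) : ℚ) + t - 1 = (s : ℚ) + t := by
      push_cast
      ring
    rw [ea, Nat.sub_add_cancel hp.one_le] at hrec
    have hR := PDiv.shiftedSum_succ_add hp hp3 ht hinv (j := s) (by omega)
    obtain ⟨n1, i1⟩ := hinv (s + 1) (by omega) (by omega)
    have ha := (PDiv.nat hp (s + 1)).add hp ht0
    have hP := (PDiv.oddPair_of_lt hp ha (k := p - 1) (by omega)).mulLeft hp
      (PDiv.harm_pred hp hp3)
    rw [sum_range_succ]
    unfold shiftedSum at hR
    generalize (((s + 1 : ℕ) : ℚ) + t) = a at *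
    have h1 := ((PDiv.nat hp 2).mulLeft hp (hP.sub hp (i1.mulLeft hp hR))).sub hp (ih (by omega))
    convert h1 using 1
    rw [pow_succ, mul_sub a⁻¹, ← mul_assoc a⁻¹ a, inv_mul_cancel₀ n1]
    push_cast
    linear_combination hrec

theorem classSum_one (hp : p.Prime) (hp3 : 3 < p) (f : ℕ → ℚ) :
    classSum p 1 f = ∑ i ∈ range (p / 6), f (p - 6 * (i + 1)) := by
  obtain ⟨n, r, rfl, hr⟩ : ∃ n r, p = 6 * n + r ∧ (r = 1 ∨ r = 5) :=
    ⟨p / 6, p % 6, by omega, mod_six_of_prime hp hp3⟩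
  have key : ∀ m, m * (6 * n + r) = 6 * (m * n) + m * r := fun m => by ring
  unfold classSum
  symm
  refine sum_nbij' (fun i => 6 * n + r - 6 * (i + 1)) (fun m => (6 * n + r - m) / 6 - 1)
    ?_ ?_ ?_ ?_ fun _ _ => rfl
  all_goals
    simp only [mem_filter, mem_Ico, mem_range, key]
    rcases hr with rfl | rfl <;> intros <;> omega

end Main

theorem stmt_8 (p : ℕ) (hp : p.Prime) (hp3 : 3 < p) :
    CongrMod p 2
      ((-1 : ℚ) ^ ((p - 1) / 2) *
        ∑ k ∈ Finset.range p,
          (Nat.choose (6 * k) (3 * k) : ℚ) * (Nat.choose (3 * k) k) / 432 ^ k * harm k)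
      (-3 * (((3 : ℚ) ^ (p - 1) - 1) / p) - 4 * (((2 : ℚ) ^ (p - 1) - 1) / p) +
        p * (3 / 2 * (((3 : ℚ) ^ (p - 1) - 1) / p) ^ 2 +
          2 * (((2 : ℚ) ^ (p - 1) - 1) / p) ^ 2)) := by
  have hp6 := mod_six_of_prime hp hp3
  have hsix : PDiv p 0 ((6 : ℚ)⁻¹) := by
    have h : ¬ (p : ℤ) ∣ (6 : ℤ) := by exact_mod_cast not_dvd_six hp hp3
    simpa using PDiv.inv_int h
  have ht : PDiv p 1 (-(p : ℚ) / 6) := by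
    rw [div_eq_mul_inv]
    exact ((PDiv.self hp).neg hp).mulRight hp hsix
  have hinv : ∀ s : ℕ, 1 ≤ s → s < p →
      (s : ℚ) + -(p : ℚ) / 6 ≠ 0 ∧ PDiv p 0 (((s : ℚ) + -(p : ℚ) / 6)⁻¹) := by
    intro s h1 h2
    have hd : ¬ (p : ℤ) ∣ 6 * s - p := by
      intro h
      have h3 : (p : ℤ) ∣ 6 * s := by simpa using h.add (dvd_refl (p : ℤ))
      have h4 : p ∣ 6 * s := by exact_mod_cast h3
      rcases hp.dvd_mul.mp h4 with h | h
      · exact not_dvd_six hp hp3 h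
      · exact Nat.not_dvd_of_pos_of_lt h1 h2 h
    have hz : ((6 * s - p : ℤ) : ℚ) ≠ 0 := by
      intro h0
      exact hd (by simp [Int.cast_eq_zero.mp h0])
    have e : (s : ℚ) + -(p : ℚ) / 6 = ((6 * s - p : ℤ) : ℚ) / 6 := by
      push_cast
      ring
    rw [e]
    refine ⟨by positivity, ?_⟩
    convert (PDiv.nat hp 6).mul hp (PDiv.inv_int hd) using 1
    rw [inv_div]
    rfl
  have hF := PDiv.sum_binomPair_harm hp hp3 ht hinv (s := p / 6) (by omega)
  have hsum : ∑ k ∈ range p, binomPair (((p / 6 : ℕ) : ℚ) + -(p : ℚ) / 6) k * harm k =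
      ∑ k ∈ Finset.range p,
        (Nat.choose (6 * k) (3 * k) : ℚ) * (Nat.choose (3 * k) k) / 432 ^ k * harm k := by
    refine sum_congr rfl fun k _ => ?_
    rw [choose_mul_choose_div_eq_binomPair]
    congr 1
    have e : (p : ℚ) = 6 * (p / 6 : ℕ) + (p % 6 : ℕ) := by exact_mod_cast (Nat.div_add_mod p 6).symm
    rcases hp6 with h | h
    · rw [h] at e
      congr 1
      rw [eq_comm, ← sub_eq_zero]
      linear_combination (1 / 6 : ℚ) * e
    · rw [h] at e
      rw [← binomPair_symm]
      congr 1
      rw [eq_comm, ← sub_eq_zero]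
      linear_combination (-1 / 6 : ℚ) * e
  have hclass : ∑ i ∈ range (p / 6), (((i + 1 : ℕ) : ℚ) + -(p : ℚ) / 6)⁻¹ =
      -6 * classSum p 1 fun m => 1 / m := by
    rw [classSum_one hp hp3, mul_sum]
    refine sum_congr rfl fun i hi => ?_
    have hi := mem_range.mp hi
    have n1 := (hinv (i + 1) (by omega) (by omega)).1
    have n2 : (p : ℚ) - 6 * (i + 1 : ℕ) ≠ 0 := by
      intro h
      apply n1
      linear_combination (-1 / 6 : ℚ) * h
    rw [Nat.cast_sub (by omega), Nat.cast_mul, Nat.cast_ofNat, inv_eq_iff_eq_inv, mul_one_div,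
      inv_div]
    field_simp
    ring
  have hsign : (-1 : ℚ) ^ ((p - 1) / 2) * (-1) ^ (p / 6) = 1 := by
    rw [← pow_add]
    exact Even.neg_one_pow (by rw [Nat.even_iff]; omega)
  have hone : PDiv p 0 ((-1 : ℚ) ^ ((p - 1) / 2)) := by
    simpa using PDiv.int hp ((-1) ^ ((p - 1) / 2))
  rw [hsum, hclass] at hF
  apply PDiv.congrMod hp
  convert (hone.mulLeft hp hF).sub hp (twelve_mul_classSum_one hp hp3) using 1
  simp only [fermatLog, fermatQuot, Nat.cast_ofNat]
  linear_combination (-12 * classSum p 1 fun m => 1 / (m : ℚ)) * hsign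
end

section
/- Let p > 3 be a prime, let a be a rational number whose denominator is coprime to p, and let m be a positive integer with a ≡ m (mod p²). Then Σ_{k=0}^{p-1} C(-a,k)·C(a-1,k)·H_k^{(2)} ≡ 2·Σ_{0<k<m, p∤k} (-1)^{m-k}/k² ≡ -E_{p²-p-2}(a) (mod p²). -/
open Finset

open Polynomial in
/-- A rational polynomial with a nonzero period is constant. -/
theorem Polynomial.eq_C_of_eval_add_eq {P : ℚ[X]} {h : ℚ} (hh : h ≠ 0)
    (hP : ∀ x, P.eval (x + h) = P.eval x) : P = C (P.eval 0) := by
  have key : ∀ n : ℕ, P.eval (n * h) = P.eval 0 := by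
    intro n
    induction n with
    | zero => simp
    | succ n ih => rw [Nat.cast_succ, add_mul, one_mul, hP, ih]
  refine Polynomial.eq_of_infinite_eval_eq _ _ ?_
  refine Set.Infinite.mono (s := Set.range fun n : ℕ => (n : ℚ) * h) ?_ ?_
  · rintro _ ⟨n, rfl⟩
    simpa using key n
  · refine Set.infinite_range_of_injective fun m n hmn => ?_
    exact_mod_cast mul_right_cancel₀ hh hmn

open Polynomial in
/-- The difference of the two sides of the duplication formula for Bernoulli polynomials. -/
noncomputable def bernoulliDuplicationDefect (n : ℕ) : ℚ[X] :=
  Polynomial.bernoulli n - C (2 ^ n / 2) * ((Polynomial.bernoulli n).comp (C (1 / 2) * X) +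
    (Polynomial.bernoulli n).comp (C (1 / 2) * X + C (1 / 2)))

theorem eval_bernoulliDuplicationDefect (n : ℕ) (x : ℚ) :
    (bernoulliDuplicationDefect n).eval x = (Polynomial.bernoulli n).eval x -
      2 ^ n / 2 * ((Polynomial.bernoulli n).eval (x / 2) +
        (Polynomial.bernoulli n).eval ((x + 1) / 2)) := by
  simp [bernoulliDuplicationDefect]
  ring_nf

open Polynomial in
theorem bernoulliDuplicationDefect_eq_C (n : ℕ) :
    bernoulliDuplicationDefect n = C ((bernoulliDuplicationDefect n).eval 0) := by
  refine Polynomial.eq_C_of_eval_add_eq one_ne_zero fun x => ?_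
  simp only [eval_bernoulliDuplicationDefect]
  rw [show (x + 1 + 1) / 2 = 1 + x / 2 by ring, add_comm x 1, bernoulli_eval_one_add,
    bernoulli_eval_one_add]
  rcases n with _ | n
  · simp
  · simp only [Nat.add_sub_cancel, div_pow, pow_succ]
    field_simp
    ring

open Polynomial in
theorem derivative_bernoulliDuplicationDefect (n : ℕ) :
    derivative (bernoulliDuplicationDefect (n + 1)) =
      C (n + 1 : ℚ) * bernoulliDuplicationDefect n := by
  simp only [bernoulliDuplicationDefect, derivative_sub, derivative_mul, derivative_add,
    derivative_comp, derivative_C, derivative_X, derivative_bernoulli_add_one, zero_mul, zero_add,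
    add_zero, mul_one, mul_comp, add_comp, natCast_comp, one_comp]
  rw [show (2 : ℚ) ^ (n + 1) / 2 = 2 ^ n / 2 * 2 by ring]
  have h2 : (C (2 : ℚ)) * C (1 / 2) = 1 := by rw [← C_mul]; norm_num
  simp only [C_mul, C_add, C_1, map_natCast]
  linear_combination (-C (2 ^ n / 2) * ((n : ℚ[X]) + 1) *
    ((Polynomial.bernoulli n).comp (C (1 / 2) * X) +
    (Polynomial.bernoulli n).comp (C (1 / 2) * X + C (1 / 2)))) * h2

open Polynomial in
theorem bernoulliDuplicationDefect_eq_zero (n : ℕ) : bernoulliDuplicationDefect n = 0 := by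
  have h := derivative_bernoulliDuplicationDefect n
  rw [bernoulliDuplicationDefect_eq_C (n + 1), derivative_C] at h
  refine (mul_eq_zero.1 h.symm).resolve_left ?_
  exact C_ne_zero.2 (by positivity)

theorem bpoly_duplication (n : ℕ) (x : ℚ) :
    bpoly n x = 2 ^ n / 2 * (bpoly n (x / 2) + bpoly n ((x + 1) / 2)) := by
  have h := eval_bernoulliDuplicationDefect n x
  rw [bernoulliDuplicationDefect_eq_zero, Polynomial.eval_zero] at h
  exact sub_eq_zero.1 h.symm

theorem epoly_add_one (n : ℕ) (x : ℚ) : epoly n (x + 1) + epoly n x = 2 * x ^ n := by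
  have h1 : bpoly (n + 1) (x + 1) = bpoly (n + 1) x + (n + 1) * x ^ n := by
    simpa [bpoly, add_comm] using Polynomial.bernoulli_eval_one_add (n + 1) x
  have h2 := bpoly_duplication (n + 1) x
  have h3 : (n + 1 : ℚ) ≠ 0 := by positivity
  unfold epoly
  field_simp
  linear_combination h1 + 2 * h2

theorem epoly_zero_of_even {n : ℕ} (hn : Even n) (h0 : 0 < n) : epoly n 0 = 0 := by
  have : bernoulli (n + 1) = 0 := bernoulli_eq_zero_of_odd hn.add_one (by omega)
  simp [epoly, bpoly, this]

open Polynomial in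
theorem exists_eval_eq_epoly (n : ℕ) : ∃ P : ℚ[X], ∀ x, P.eval x = epoly n x := by
  refine ⟨C (2 / (n + 1 : ℚ)) * (Polynomial.bernoulli (n + 1) -
    C (2 ^ (n + 1)) * (Polynomial.bernoulli (n + 1)).comp (C (1 / 2) * X)), fun x => ?_⟩
  simp only [epoly, bpoly, eval_mul, eval_sub, eval_C, eval_comp, eval_X]
  ring_nf

open Polynomial in
theorem epoly_eq_pow_sub_sum (n : ℕ) (x : ℚ) :
    epoly n x = x ^ n - 1 / 2 * ∑ j ∈ range n, n.choose j * epoly j x := by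
  choose E hE using exists_eval_eq_epoly
  set P : ℚ[X] := E n - (X ^ n - C (1 / 2) * ∑ j ∈ range n, C (n.choose j : ℚ) * E j) with hP
  have heval : ∀ y, P.eval y =
      epoly n y - (y ^ n - 1 / 2 * ∑ j ∈ range n, n.choose j * epoly j y) := by
    intro y
    simp only [hP, eval_sub, eval_mul, eval_pow, eval_X, eval_C, eval_finsetSum, hE]
  have hanti : ∀ y, P.eval (y + 1) = -P.eval y := by
    intro y
    have hsum : ∑ j ∈ range n, n.choose j * epoly j (y + 1) +
        ∑ j ∈ range n, n.choose j * epoly j y = 2 * ((y + 1) ^ n - y ^ n) := by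
      rw [add_pow, sum_range_succ, ← sum_add_distrib]
      simp only [one_pow, mul_one, Nat.choose_self, Nat.cast_one, add_sub_cancel_right, mul_sum]
      refine sum_congr rfl fun j _ => ?_
      linear_combination (n.choose j : ℚ) * epoly_add_one j y
    rw [heval, heval]
    linear_combination epoly_add_one n y + 1 / 2 * hsum
  have hconst := Polynomial.eq_C_of_eval_add_eq (P := P) two_ne_zero fun y => by
    rw [← one_add_one_eq_two, ← add_assoc, hanti, hanti, neg_neg]
  have h0 : P.eval 0 = 0 := by
    have h1 := hanti 0
    rw [hconst] at h1
    simp only [eval_C] at h1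
    linarith
  have := heval x
  rw [hconst, h0] at this
  simp only [map_zero, eval_zero] at this
  linarith

/-- The subring of `p`-integral rational numbers. -/
def pIntegral (p : ℕ) [Fact p.Prime] : Subring ℚ where
  carrier := {q | padicNorm p q ≤ 1}
  zero_mem' := by simp
  one_mem' := by simp
  add_mem' hx hy := padicNorm.nonarchimedean.trans (max_le hx hy)
  mul_mem' hx hy := by
    simp only [Set.mem_ofPred_eq, padicNorm.mul] at *
    exact mul_le_one₀ hx (padicNorm.nonneg _) hy
  neg_mem' hx := by simpa using hx

theorem CongrMod.refl {p n : ℕ} (x : ℚ) : CongrMod p n x x := Or.inl rfl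

section Congruences

variable {p : ℕ} [hp : Fact p.Prime]

theorem mem_pIntegral {q : ℚ} : q ∈ pIntegral p ↔ padicNorm p q ≤ 1 := Iff.rfl

theorem mem_pIntegral_of_not_dvd_den {q : ℚ} (h : ¬ p ∣ q.den) : q ∈ pIntegral p := by
  have := Padic.norm_rat_le_one h
  rw [Padic.eq_padicNorm] at this
  exact_mod_cast this

theorem div_natCast_mem_pIntegral {q : ℚ} (hq : q ∈ pIntegral p) {k : ℕ} (hk : ¬ p ∣ k) :
    q / k ∈ pIntegral p := by
  rw [mem_pIntegral, padicNorm.div, (padicNorm.nat_eq_one_iff k).2 hk, div_one]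
  exact hq

theorem congrMod_iff {n : ℕ} {x y : ℚ} :
    CongrMod p n x y ↔ ∃ z ∈ pIntegral p, x - y = p ^ n * z := by
  have hp0 : (p : ℚ) ≠ 0 := by exact_mod_cast hp.out.ne_zero
  have hp1 : (1 : ℚ) < p := by exact_mod_cast hp.out.one_lt
  have h1 : (∃ z ∈ pIntegral p, x - y = p ^ n * z) ↔ (x - y) / p ^ n ∈ pIntegral p := by
    constructor
    · rintro ⟨z, hz, h⟩
      rwa [h, mul_div_cancel_left₀ _ (pow_ne_zero _ hp0)]
    · exact fun h => ⟨_, h, by field_simp⟩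
  rw [h1, mem_pIntegral]
  by_cases hxy : x = y
  · simp [CongrMod, hxy]
  · have h2 : (x - y) / p ^ n ≠ 0 := div_ne_zero (sub_ne_zero.2 hxy) (pow_ne_zero _ hp0)
    rw [padicNorm.eq_zpow_of_nonzero h2, padicValRat.div (sub_ne_zero.2 hxy) (pow_ne_zero _ hp0),
      padicValRat.pow, padicValRat.self hp.out.one_lt, zpow_le_one_iff_right₀ hp1]
    simp [CongrMod, hxy]

namespace CongrMod

variable {n : ℕ} {x y z w : ℚ}

theorem trans (h : CongrMod p n x y) (h' : CongrMod p n y z) : CongrMod p n x z := by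
  rw [congrMod_iff] at *
  obtain ⟨u, hu, e⟩ := h
  obtain ⟨v, hv, e'⟩ := h'
  exact ⟨u + v, add_mem hu hv, by linear_combination e + e'⟩

theorem add (h : CongrMod p n x y) (h' : CongrMod p n z w) :
    CongrMod p n (x + z) (y + w) := by
  rw [congrMod_iff] at *
  obtain ⟨u, hu, e⟩ := h
  obtain ⟨v, hv, e'⟩ := h'
  exact ⟨u + v, add_mem hu hv, by linear_combination e + e'⟩

theorem neg (h : CongrMod p n x y) : CongrMod p n (-x) (-y) := by
  rw [congrMod_iff] at *
  obtain ⟨u, hu, e⟩ := h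
  exact ⟨-u, neg_mem hu, by linear_combination -e⟩

theorem symm (h : CongrMod p n x y) : CongrMod p n y x := by
  rw [congrMod_iff] at *
  obtain ⟨u, hu, e⟩ := h
  exact ⟨-u, neg_mem hu, by linear_combination -e⟩

theorem sub (h : CongrMod p n x y) (h' : CongrMod p n z w) :
    CongrMod p n (x - z) (y - w) := by
  simpa only [sub_eq_add_neg] using h.add h'.neg

theorem mul (h : CongrMod p n x y) (h' : CongrMod p n z w) (hy : y ∈ pIntegral p)
    (hz : z ∈ pIntegral p) : CongrMod p n (x * z) (y * w) := by
  rw [congrMod_iff] at *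
  obtain ⟨u, hu, e⟩ := h
  obtain ⟨v, hv, e'⟩ := h'
  exact ⟨u * z + y * v, add_mem (mul_mem hu hz) (mul_mem hy hv),
    by linear_combination z * e + y * e'⟩

theorem const_mul {c : ℚ} (hc : c ∈ pIntegral p) (h : CongrMod p n x y) :
    CongrMod p n (c * x) (c * y) := by
  rw [congrMod_iff] at *
  obtain ⟨u, hu, e⟩ := h
  exact ⟨c * u, mul_mem hc hu, by linear_combination c * e⟩

theorem div_natCast {k : ℕ} (hk : ¬ p ∣ k) (h : CongrMod p n x y) :
    CongrMod p n (x / k) (y / k) := by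
  rw [congrMod_iff] at *
  obtain ⟨u, hu, e⟩ := h
  exact ⟨u / k, div_natCast_mem_pIntegral hu hk, by rw [← sub_div, e, mul_div_assoc]⟩

theorem sum {ι : Type*} {s : Finset ι} {f g : ι → ℚ}
    (h : ∀ i ∈ s, CongrMod p n (f i) (g i)) : CongrMod p n (∑ i ∈ s, f i) (∑ i ∈ s, g i) := by
  classical
  induction s using Finset.induction_on with
  | empty => exact refl _
  | insert a s ha ih =>
    rw [sum_insert ha, sum_insert ha]
    exact (h a (mem_insert_self _ _)).add (ih fun i hi => h i (mem_insert_of_mem hi))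

theorem pow (h : CongrMod p n x y) (hx : x ∈ pIntegral p) (hy : y ∈ pIntegral p) (k : ℕ) :
    CongrMod p n (x ^ k) (y ^ k) := by
  induction k with
  | zero => simpa using refl 1
  | succ k ih => simpa only [pow_succ] using ih.mul h (pow_mem hy k) hx

end CongrMod

theorem epoly_congrMod (hp2 : p ≠ 2) {n : ℕ} {x y : ℚ} (h : CongrMod p n x y)
    (hx : x ∈ pIntegral p) (hy : y ∈ pIntegral p) (k : ℕ) :
    CongrMod p n (epoly k x) (epoly k y) := by
  induction k using Nat.strong_induction_on with
  | _ k ih =>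
    have hhalf : (1 / 2 : ℚ) ∈ pIntegral p := by
      have := div_natCast_mem_pIntegral (one_mem (pIntegral p)) (k := 2)
        fun h => hp2 ((Nat.prime_dvd_prime_iff_eq hp.out Nat.prime_two).1 h)
      exact_mod_cast this
    rw [epoly_eq_pow_sub_sum k x, epoly_eq_pow_sub_sum k y]
    refine (h.pow hx hy k).sub (.const_mul hhalf (.sum fun j hj => ?_))
    exact .const_mul (natCast_mem _ _) (ih j (mem_range.1 hj))

theorem not_dvd_factorial_of_lt {k : ℕ} (hk : k < p) : ¬ p ∣ k.factorial :=
  fun h => absurd ((hp.out.dvd_factorial).1 h) (by omega)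

theorem gchoose_mem_pIntegral {x : ℚ} (hx : x ∈ pIntegral p) {k : ℕ} (hk : k < p) :
    gchoose x k ∈ pIntegral p :=
  div_natCast_mem_pIntegral (prod_mem fun j _ => sub_mem hx (natCast_mem _ j))
    (not_dvd_factorial_of_lt hk)

theorem gchoose_congrMod {n : ℕ} {x y : ℚ} (h : CongrMod p n x y) (hx : x ∈ pIntegral p)
    (hy : y ∈ pIntegral p) {k : ℕ} (hk : k < p) :
    CongrMod p n (gchoose x k) (gchoose y k) := by
  refine .div_natCast (not_dvd_factorial_of_lt hk) ?_
  clear hk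
  induction k with
  | zero => simpa using CongrMod.refl 1
  | succ k ih =>
    rw [prod_range_succ, prod_range_succ]
    exact ih.mul (h.sub (.refl _)) (prod_mem fun j _ => sub_mem hy (natCast_mem _ j))
      (sub_mem hx (natCast_mem _ k))

theorem div_succ_mem_pIntegral {q : ℚ} (hq : q ∈ pIntegral p) {k : ℕ} (hk : k + 1 < p) :
    q / (k + 1) ∈ pIntegral p := by
  have := div_natCast_mem_pIntegral hq (k := k + 1)
    (fun h => absurd (Nat.le_of_dvd k.succ_pos h) (by omega))
  exact_mod_cast this

theorem harm2_mem_pIntegral {k : ℕ} (hk : k < p) : harm2 k ∈ pIntegral p := by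
  refine sum_mem fun j hj => ?_
  have hj := mem_range.1 hj
  rw [← one_div_pow]
  exact pow_mem (div_succ_mem_pIntegral (one_mem _) (by omega)) 2

end Congruences

/-- The product `∏_{j=1}^{n} (1 - x² / j²)`. -/
def sineProduct (n : ℕ) (x : ℚ) : ℚ := ∏ j ∈ range n, (1 - x ^ 2 / (j + 1) ^ 2)

theorem sineProduct_zero (x : ℚ) : sineProduct 0 x = 1 := prod_range_zero _

theorem sineProduct_succ (n : ℕ) (x : ℚ) :
    sineProduct (n + 1) x = sineProduct n x * (1 - x ^ 2 / (n + 1) ^ 2) := prod_range_succ _ _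

theorem gchoose_mul_gchoose_succ (k : ℕ) (x : ℚ) :
    gchoose (-(x + 1)) (k + 1) * gchoose x (k + 1) =
      -(x * (x + (k + 1))) * sineProduct k x / (k + 1) ^ 2 := by
  have hrec : ∀ (y : ℚ) (n : ℕ), gchoose y (n + 1) = gchoose y n * (y - n) / (n + 1) := by
    intro y n
    simp only [gchoose, prod_range_succ, Nat.factorial_succ]
    push_cast
    field_simp
  induction k with
  | zero => simp [gchoose, sineProduct]; ring
  | succ k ih =>
    rw [hrec _ (k + 1), hrec _ (k + 1), sineProduct_succ]
    have h1 : (k + 1 : ℚ) ≠ 0 := by positivity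
    have h2 : (k + 1 + 1 : ℚ) ≠ 0 := by positivity
    push_cast
    field_simp at ih ⊢
    linear_combination (-(x + 1) - (k + 1)) * (x - (k + 1)) * ih

theorem gchoose_mul_gchoose_succ_add (k : ℕ) (x : ℚ) :
    gchoose (-(x + 1)) (k + 1) * gchoose x (k + 1) + gchoose (-x) (k + 1) * gchoose (x - 1) (k + 1)
      = 2 * (sineProduct (k + 1) x - sineProduct k x) := by
  have h := gchoose_mul_gchoose_succ k (-x)
  have hneg : sineProduct k (-x) = sineProduct k x := by simp [sineProduct]
  rw [hneg, show -(-x + 1) = x - 1 by ring, mul_comm] at h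
  rw [gchoose_mul_gchoose_succ, h, sineProduct_succ]
  have h1 : (k + 1 : ℚ) ≠ 0 := by positivity
  field_simp
  ring

theorem harm2_succ (k : ℕ) : harm2 (k + 1) = harm2 k + 1 / (k + 1) ^ 2 := sum_range_succ _ _

theorem sum_gchoose_add_sum_gchoose (n : ℕ) (x : ℚ) :
    ∑ k ∈ range (n + 1), gchoose (-(x + 1)) k * gchoose x k * harm2 k +
      ∑ k ∈ range (n + 1), gchoose (-x) k * gchoose (x - 1) k * harm2 k =
    2 * (sineProduct n x * harm2 n - ∑ k ∈ range n, sineProduct k x / (k + 1) ^ 2) := by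
  induction n with
  | zero => simp [harm2]
  | succ n ih =>
    rw [sum_range_succ _ (n + 1), sum_range_succ _ (n + 1), harm2_succ]
    rw [add_add_add_comm, ih, ← add_mul, gchoose_mul_gchoose_succ_add,
      sum_range_succ (fun k : ℕ => sineProduct k x / ((k : ℚ) + 1) ^ 2)]
    ring

theorem sq_mul_sum_sineProduct (n : ℕ) (x : ℚ) :
    x ^ 2 * ∑ k ∈ range n, sineProduct k x / (k + 1) ^ 2 = 1 - sineProduct n x := by
  induction n with
  | zero => simp [sineProduct_zero]
  | succ n ih =>
    rw [sum_range_succ, mul_add, ih, sineProduct_succ]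
    ring

section SineProductCongruences

variable {p : ℕ} [hp : Fact p.Prime]

theorem exists_mem_pIntegral_prod_one_sub {t : ℤ} (ht : ¬ (p : ℤ) ∣ t) :
    ∃ z ∈ pIntegral p, ∏ j ∈ range (p - 1), (1 - (t : ℚ) / (j + 1)) = p * z := by
  have hp0 : (p : ℤ) ≠ 0 := by exact_mod_cast hp.out.ne_zero
  have hpos : 0 < t % p :=
    lt_of_le_of_ne (Int.emod_nonneg _ hp0) fun h => ht (Int.dvd_of_emod_eq_zero h.symm)
  have hlt : t % p < p := Int.emod_lt_of_pos _ (by exact_mod_cast hp.out.pos)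
  obtain ⟨i, hi⟩ : ∃ i : ℕ, t % p = i + 1 := ⟨(t % p - 1).toNat, by omega⟩
  have hip : i + 1 < p := by omega
  have hmem : i ∈ range (p - 1) := mem_range.2 (by omega)
  have hti : t = i + 1 + p * (t / p) := by rw [← hi]; exact (Int.emod_add_mul_ediv t p).symm
  have hti' : (t : ℚ) = i + 1 + p * (t / p : ℤ) := by exact_mod_cast hti
  refine ⟨-((t / p : ℤ) / (i + 1)) * ∏ j ∈ (range (p - 1)).erase i, (1 - (t : ℚ) / (j + 1)),
    mul_mem (neg_mem (div_succ_mem_pIntegral (intCast_mem _ _) hip)) (prod_mem fun j hj =>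
      sub_mem (one_mem _) (div_succ_mem_pIntegral (intCast_mem _ _) ?_)), ?_⟩
  · have := mem_range.1 (mem_of_mem_erase hj)
    omega
  · rw [← mul_prod_erase _ _ hmem, ← mul_assoc]
    congr 1
    have h1 : (i + 1 : ℚ) ≠ 0 := by positivity
    rw [hti']
    field_simp
    ring

theorem sineProduct_congrMod_zero {m : ℕ} (hm : ¬ p ∣ m) :
    CongrMod p 2 (sineProduct (p - 1) m) 0 := by
  have hm' : ¬ (p : ℤ) ∣ m := by exact_mod_cast hm
  obtain ⟨u, hu, e⟩ := exists_mem_pIntegral_prod_one_sub hm'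
  obtain ⟨v, hv, e'⟩ := exists_mem_pIntegral_prod_one_sub (mt (dvd_neg.1) hm')
  refine congrMod_iff.2 ⟨u * v, mul_mem hu hv, ?_⟩
  have : sineProduct (p - 1) m = (p * u) * (p * v) := by
    rw [← e, ← e', ← prod_mul_distrib]
    refine prod_congr rfl fun j _ => ?_
    push_cast
    rw [← div_pow]
    ring
  rw [this]
  ring

theorem sineProduct_congrMod_one {m : ℕ} (hm : p ∣ m) {n : ℕ} (hn : n < p) :
    CongrMod p 2 (sineProduct n m) 1 := by
  induction n with
  | zero => exact sineProduct_zero _ ▸ .refl _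
  | succ n ih =>
    obtain ⟨c, rfl⟩ := hm
    have h : CongrMod p 2 (1 - ((p * c : ℕ) : ℚ) ^ 2 / (n + 1) ^ 2) 1 := by
      refine congrMod_iff.2 ⟨-(c / (n + 1)) ^ 2,
        neg_mem (pow_mem (div_succ_mem_pIntegral (natCast_mem _ _) hn) 2), ?_⟩
      push_cast
      rw [← div_pow]
      ring
    rw [sineProduct_succ]
    have h1 := (ih (by omega)).mul h (one_mem _) (sub_mem (one_mem _) ?_)
    · rwa [one_mul] at h1
    · rw [← div_pow]
      exact pow_mem (div_succ_mem_pIntegral (natCast_mem _ _) hn) 2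

theorem sum_gchoose_natCast_add_one_congrMod {m : ℕ} (hm : 0 < m) :
    CongrMod p 2
      (∑ k ∈ range p, gchoose (-((m : ℚ) + 1)) k * gchoose m k * harm2 k)
      (-(∑ k ∈ range p, gchoose (-(m : ℚ)) k * gchoose (m - 1) k * harm2 k) +
        -(if p ∣ m then 0 else 2 / (m : ℚ) ^ 2)) := by
  have hp1 : p - 1 + 1 = p := Nat.sub_add_cancel hp.out.one_le
  have hlt : p - 1 < p := Nat.sub_lt hp.out.pos one_pos
  have hsum := sum_gchoose_add_sum_gchoose (p - 1) (m : ℚ)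
  rw [hp1] at hsum
  rw [eq_sub_of_add_eq hsum, sub_eq_add_neg, add_comm]
  refine (CongrMod.refl _).add ?_
  have hm0 : (m : ℚ) ≠ 0 := by exact_mod_cast hm.ne'
  split_ifs with h
  · have hT : CongrMod p 2 (∑ k ∈ range (p - 1), sineProduct k m / ((k : ℚ) + 1) ^ 2)
        (harm2 (p - 1)) := by
      refine .sum fun k hk => ?_
      have hk := mem_range.1 hk
      have := (sineProduct_congrMod_one h (n := k) (by omega)).const_mul
        (pow_mem (div_succ_mem_pIntegral (p := p) (one_mem _) (k := k) (by omega)) 2)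
      rw [one_div_pow, one_div_mul_eq_div, mul_one] at this
      exact this
    have hH := (sineProduct_congrMod_one h hlt).mul (.refl (harm2 (p - 1))) (one_mem _)
      (harm2_mem_pIntegral hlt)
    have := (hH.sub hT).const_mul (natCast_mem (pIntegral p) 2)
    rwa [one_mul, sub_self, mul_zero, ← neg_zero] at this
  · have hsq : ∑ k ∈ range (p - 1), sineProduct k (m : ℚ) / (k + 1) ^ 2 =
        (1 - sineProduct (p - 1) m) / (m : ℚ) ^ 2 := by
      rw [← sq_mul_sum_sineProduct]
      field_simp
    rw [hsq]
    have hinv : (2 * (harm2 (p - 1) + (1 / m) ^ 2) : ℚ) ∈ pIntegral p :=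
      mul_mem (natCast_mem _ 2) (add_mem (harm2_mem_pIntegral hlt)
        (pow_mem (div_natCast_mem_pIntegral (one_mem _) h) 2))
    have := ((sineProduct_congrMod_zero h).const_mul hinv).add (.refl (-(2 / (m : ℚ) ^ 2)))
    convert this using 1 <;> ring

theorem two_mul_sum_filter_add_one (p : ℕ) {m : ℕ} (hm : 0 < m) :
    2 * ∑ k ∈ (Ico 1 (m + 1)).filter (fun k => ¬ (p ∣ k)),
        (-1 : ℚ) ^ (m + 1 - k) / (k : ℚ) ^ 2 =
      -(2 * ∑ k ∈ (Ico 1 m).filter (fun k => ¬ (p ∣ k)), (-1 : ℚ) ^ (m - k) / (k : ℚ) ^ 2) +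
        -(if p ∣ m then 0 else 2 / (m : ℚ) ^ 2) := by
  rw [sum_filter, sum_filter, sum_Ico_succ_top (by omega)]
  have : ∀ k ∈ Ico 1 m, (if ¬ p ∣ k then (-1 : ℚ) ^ (m + 1 - k) / (k : ℚ) ^ 2 else 0) =
      -(if ¬ p ∣ k then (-1 : ℚ) ^ (m - k) / (k : ℚ) ^ 2 else 0) := by
    intro k hk
    rw [Nat.succ_sub (mem_Ico.1 hk).2.le, pow_succ]
    split_ifs <;> ring
  rw [sum_congr rfl this, sum_neg_distrib]
  split_ifs <;> simp
  ring

theorem pow_congrMod_inv_sq (hp3 : 3 < p) (m : ℕ) :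
    CongrMod p 2 (if p ∣ m then 0 else 2 / (m : ℚ) ^ 2) (2 * (m : ℚ) ^ (p ^ 2 - p - 2)) := by
  have hn : p ^ 2 - p = p * (p - 1) := by rw [Nat.mul_sub, mul_one, sq]
  have hge : p * (p - 1) ≥ 4 * 3 := Nat.mul_le_mul (by omega) (by omega)
  split_ifs with h
  · obtain ⟨c, rfl⟩ := h
    obtain ⟨r, hr⟩ : ∃ r, p ^ 2 - p - 2 = 2 + r := ⟨p ^ 2 - p - 2 - 2, by omega⟩
    refine congrMod_iff.2 ⟨((-(2 * c ^ 2 * (p * c) ^ r) : ℤ) : ℚ), intCast_mem _ _, ?_⟩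
    rw [hr]
    push_cast
    ring
  · have hcop : m.Coprime (p ^ 2) := Nat.Coprime.pow_right 2
      ((Nat.Prime.coprime_iff_not_dvd hp.out).2 h).symm
    have htot := Nat.ModEq.pow_totient hcop
    rw [Nat.totient_prime_pow hp.out two_pos, show p ^ (2 - 1) * (p - 1) = p ^ 2 - p by
      rw [hn, pow_one]] at htot
    obtain ⟨c, hc⟩ := htot.symm.dvd
    push_cast at hc
    have hc' : (m : ℚ) ^ (p ^ 2 - p) - 1 = p ^ 2 * c := by exact_mod_cast hc
    have hm0 : (m : ℚ) ≠ 0 := by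
      rintro h0
      exact h (by simp [Nat.cast_eq_zero.1 h0])
    have hpow : (m : ℚ) ^ (p ^ 2 - p) = m ^ (p ^ 2 - p - 2) * m ^ 2 := by
      rw [← pow_add]; congr 1; omega
    refine congrMod_iff.2 ⟨(-2 * c : ℤ) * (1 / m) ^ 2, mul_mem (intCast_mem _ _)
      (pow_mem (div_natCast_mem_pIntegral (one_mem _) h) 2), ?_⟩
    rw [hpow] at hc'
    field_simp
    push_cast
    linear_combination -2 * hc'

theorem sum_gchoose_natCast_congrMod {m : ℕ} (hm : 0 < m) :
    CongrMod p 2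
      (∑ k ∈ range p, gchoose (-(m : ℚ)) k * gchoose (m - 1) k * harm2 k)
      (2 * ∑ k ∈ (Ico 1 m).filter (fun k => ¬ (p ∣ k)), (-1 : ℚ) ^ (m - k) / (k : ℚ) ^ 2) := by
  induction m, hm using Nat.le_induction with
  | base =>
    left
    rw [sum_eq_zero]
    · simp
    · rintro (_ | k) _
      · simp [harm2]
      · simp [gchoose, prod_range_succ']
  | succ m hm ih =>
    rw [two_mul_sum_filter_add_one p hm]
    have := sum_gchoose_natCast_add_one_congrMod (p := p) hm
    push_cast
    rw [add_sub_cancel_right]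
    exact this.trans (ih.neg.add (.refl _))

theorem sum_filter_congrMod_neg_epoly (hp3 : 3 < p) {m : ℕ} (hm : 0 < m) :
    CongrMod p 2
      (2 * ∑ k ∈ (Ico 1 m).filter (fun k => ¬ (p ∣ k)), (-1 : ℚ) ^ (m - k) / (k : ℚ) ^ 2)
      (-(epoly (p ^ 2 - p - 2) m)) := by
  induction m, hm using Nat.le_induction with
  | base =>
    left
    have hn : p ^ 2 - p = p * (p - 1) := by rw [Nat.mul_sub, mul_one, sq]
    have hge : p * (p - 1) ≥ 4 * 3 := Nat.mul_le_mul (by omega) (by omega)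
    have heven : Even (p ^ 2 - p - 2) := by
      rw [hn]
      exact (Nat.even_mul_pred_self p).tsub even_two
    have h := epoly_add_one (p ^ 2 - p - 2) 0
    rw [epoly_zero_of_even heven (by omega), zero_pow (by omega)] at h
    simp only [zero_add, add_zero, mul_zero] at h
    simp [h]
  | succ m hm ih =>
    rw [two_mul_sum_filter_add_one p hm]
    have hE := epoly_add_one (p ^ 2 - p - 2) (m : ℚ)
    have := ih.neg.add (pow_congrMod_inv_sq hp3 m).neg
    convert this using 1
    push_cast
    linear_combination -hE

theorem sum_gchoose_congrMod {x y : ℚ} (h : CongrMod p 2 x y) (hx : x ∈ pIntegral p)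
    (hy : y ∈ pIntegral p) :
    CongrMod p 2 (∑ k ∈ range p, gchoose (-x) k * gchoose (x - 1) k * harm2 k)
      (∑ k ∈ range p, gchoose (-y) k * gchoose (y - 1) k * harm2 k) := by
  refine .sum fun k hk => ?_
  have hk := mem_range.1 hk
  have hx1 := sub_mem hx (one_mem _)
  have hy1 := sub_mem hy (one_mem _)
  refine CongrMod.mul (CongrMod.mul ?_ ?_ ?_ ?_) (.refl _)
    (mul_mem (gchoose_mem_pIntegral (neg_mem hy) hk) (gchoose_mem_pIntegral hy1 hk))
    (harm2_mem_pIntegral hk)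
  · exact gchoose_congrMod h.neg (neg_mem hx) (neg_mem hy) hk
  · exact gchoose_congrMod (h.sub (.refl 1)) hx1 hy1 hk
  · exact gchoose_mem_pIntegral (neg_mem hy) hk
  · exact gchoose_mem_pIntegral hx1 hk

end SineProductCongruences

theorem stmt_9 (p : ℕ) (hp : p.Prime) (hp3 : 3 < p) (a : ℚ) (ha : ¬ (p ∣ a.den))
    (m : ℕ) (hm : 0 < m) (ham : CongrMod p 2 a m) :
    CongrMod p 2
      (∑ k ∈ Finset.range p, gchoose (-a) k * gchoose (a - 1) k * harm2 k)
      (2 * ∑ k ∈ (Finset.Ico 1 m).filter (fun k => ¬ (p ∣ k)),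
        (-1 : ℚ) ^ (m - k) / (k : ℚ) ^ 2) ∧
    CongrMod p 2
      (2 * ∑ k ∈ (Finset.Ico 1 m).filter (fun k => ¬ (p ∣ k)),
        (-1 : ℚ) ^ (m - k) / (k : ℚ) ^ 2)
      (-(epoly (p ^ 2 - p - 2) a)) := by
  have : Fact p.Prime := ⟨hp⟩
  have haI : a ∈ pIntegral p := mem_pIntegral_of_not_dvd_den ha
  have hmI : (m : ℚ) ∈ pIntegral p := natCast_mem _ m
  exact ⟨(sum_gchoose_congrMod ham haI hmI).trans (sum_gchoose_natCast_congrMod hm),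
    (sum_filter_congrMod_neg_epoly hp3 hm).trans
      (epoly_congrMod (by omega) ham.symm hmI haI _).neg⟩
end
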